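/- For every integer n ≥ 2, every p ∈ (0,1), and every nontrivial monotone symmetric subset A of {0,1}^n, the derivative with respect to p of the polynomial map p ↦ μ_{n,p}(A) satisfies dμ_p(A)/dp ≥ ( s(n) / ( p(1−p) · c_LS(p) ) ) · μ_p(A)(1 − μ_p(A)). -/

import Mathlib

open Finset

/-- Weight of a point `x ∈ {0,1}^n` under the product Bernoulli(p) measure:
`p^{∑ xᵢ} (1-p)^{∑ (1-xᵢ)}`. -/
noncomputable def muW (n : ℕ) (p : ℝ) (x : Fin n → Bool) : ℝ :=
  ∏ i : Fin n, if x i then p else 1 - p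

/-- The measure `μ_{n,p}(A)` of a subset `A ⊆ {0,1}^n`. -/
noncomputable def muP (n : ℕ) (p : ℝ) (A : Finset (Fin n → Bool)) : ℝ :=
  ∑ x ∈ A, muW n p x

/-- Expectation `∫ f dμ_{n,p}` of a real function on `{0,1}^n`. -/
noncomputable def muE (n : ℕ) (p : ℝ) (f : (Fin n → Bool) → ℝ) : ℝ :=
  ∑ x : Fin n → Bool, muW n p x * f x

/-- `A` is monotone: `x ∈ A` and `x ≤ y` coordinatewise imply `y ∈ A`. -/
def MonotoneSet (n : ℕ) (A : Finset (Fin n → Bool)) : Prop :=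
  ∀ x ∈ A, ∀ y : Fin n → Bool, (∀ i, x i ≤ y i) → y ∈ A

/-- `A` is symmetric: invariant under a transitive subgroup of permutations of coordinates. -/
def SymmetricSet (n : ℕ) (A : Finset (Fin n → Bool)) : Prop :=
  ∃ G : Subgroup (Equiv.Perm (Fin n)),
    (∀ i j : Fin n, ∃ g ∈ G, g i = j) ∧
    (∀ g ∈ G, ∀ x ∈ A, (fun i => x (g⁻¹ i)) ∈ A)

/-- Discrete gradient `∇_i f`. -/
noncomputable def grad (n : ℕ) (i : Fin n) (f : (Fin n → Bool) → ℝ)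
    (x : Fin n → Bool) : ℝ :=
  f (Function.update x i true) - f (Function.update x i false)

/-- The operator `Δ_i f = f - ∫ f dμ_{1,p}(x_i)`. -/
noncomputable def del (n : ℕ) (p : ℝ) (i : Fin n) (f : (Fin n → Bool) → ℝ)
    (x : Fin n → Bool) : ℝ :=
  f x - (p * f (Function.update x i true) + (1 - p) * f (Function.update x i false))

open Classical in
/-- Influence of coordinate `i` on a function `f`: the `μ_{n,p}`-probability
that `f` is not constant on the `i`-th fiber. -/
noncomputable def infl (n : ℕ) (p : ℝ) (i : Fin n) (f : (Fin n → Bool) → ℝ) : ℝ :=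
  muP n p (Finset.univ.filter fun x =>
    f (Function.update x i true) ≠ f (Function.update x i false))

open Classical in
/-- Influence of coordinate `i` on a set `A`. -/
noncomputable def inflSet (n : ℕ) (p : ℝ) (i : Fin n) (A : Finset (Fin n → Bool)) : ℝ :=
  muP n p (Finset.univ.filter fun x =>
    ¬((Function.update x i true ∈ A) ↔ (Function.update x i false ∈ A)))

/-- Entropy of a (nonnegative) function with respect to `μ_{n,p}`. -/
noncomputable def ent (n : ℕ) (p : ℝ) (g : (Fin n → Bool) → ℝ) : ℝ :=
  muE n p (fun x => g x * Real.log (g x)) - muE n p g * Real.log (muE n p g)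

/-- Variance of a function with respect to `μ_{n,p}`. -/
noncomputable def varE (n : ℕ) (p : ℝ) (f : (Fin n → Bool) → ℝ) : ℝ :=
  muE n p (fun x => f x ^ 2) - (muE n p f) ^ 2

/-- Conditional expectation `E[f | x_1, …, x_j]` under `μ_{n,p}`:
average over the last `n - j` coordinates. -/
noncomputable def condE (n : ℕ) (p : ℝ) (j : ℕ) (f : (Fin n → Bool) → ℝ)
    (x : Fin n → Bool) : ℝ :=
  ∑ y : Fin n → Bool,
    (∏ i : Fin n, if (i : ℕ) < j then (if y i = x i then (1 : ℝ) else 0)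
      else (if y i then p else 1 - p)) * f y

/-- The logarithmic Sobolev constant of the two-point Bernoulli(p) space. -/
noncomputable def cLS (p : ℝ) : ℝ :=
  if p = 1 / 2 then 2 else (Real.log (1 - p) - Real.log p) / (1 - 2 * p)

/-- The sequence `s(n)` of Theorem 4.1. -/
noncomputable def sseq (n : ℕ) : ℝ :=
  Real.log n -
    max (Real.log ((Real.exp 1 ^ (2 + 4 / Real.exp 1) / (2 : ℝ) ^ (5 + 4 / Real.exp 1)) *
        Real.log ((n : ℝ) / Real.log n ^ 2) ^ (3 + 4 / Real.exp 1)))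
      (2 * Real.log (Real.log n))

lemma sinh_cvx : ConvexOn ℝ (Set.Ici (0:ℝ)) Real.sinh := by
  apply convexOn_of_deriv2_nonneg (convex_Ici 0) Real.continuous_sinh.continuousOn
    Real.differentiable_sinh.differentiableOn
  · simp only [Real.deriv_sinh]; exact Real.differentiable_cosh.differentiableOn
  · intro x hx
    simp only [interior_Ici, Set.mem_Ioi] at hx
    simp [Real.deriv_sinh, Real.deriv_cosh, hx.le]

lemma sinh_scale {t r : ℝ} (ht : 0 ≤ t) (htr : t ≤ r) (hr : 0 < r) :
    r * Real.sinh t ≤ t * Real.sinh r := by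
  have h := sinh_cvx.2 (show (0:ℝ) ∈ Set.Ici 0 by simp) (show r ∈ Set.Ici 0 from hr.le)
    (show 0 ≤ 1 - t / r by rw [sub_nonneg, div_le_one hr]; exact htr)
    (show 0 ≤ t / r by positivity) (by ring)
  simp only [smul_eq_mul, mul_zero, zero_add, Real.sinh_zero] at h
  rw [div_mul_cancel₀ _ hr.ne', div_mul_eq_mul_div, le_div_iff₀ hr] at h
  linarith

noncomputable def GG (k t : ℝ) : ℝ :=
  t * (Real.sinh t / Real.cosh t) - Real.log (Real.cosh t) + k / Real.cosh t

lemma GG_deriv (k t : ℝ) :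
    HasDerivAt (GG k) ((t - k * Real.sinh t) / Real.cosh t ^ 2) t := by
  have hc := Real.cosh_pos t
  have h := (((hasDerivAt_id t).mul ((Real.hasDerivAt_sinh t).div (Real.hasDerivAt_cosh t) hc.ne')).sub
    ((Real.hasDerivAt_cosh t).log hc.ne')).add
    ((hasDerivAt_const t k).div (Real.hasDerivAt_cosh t) hc.ne')
  have h2 := h.congr_deriv (g' := (t - k * Real.sinh t) / Real.cosh t ^ 2) (by
    have := Real.cosh_sq t
    simp only [id, Pi.div_apply]
    field_simp
    linear_combination t * this)
  exact h2

lemma GG_even (k t : ℝ) : GG k (-t) = GG k t := by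
  simp [GG, Real.sinh_neg, Real.cosh_neg]; ring

lemma GG_le_pos {k r t : ℝ} (hr : 0 ≤ r) (ht : 0 ≤ t) (hk : k * Real.sinh r = r)
    (hk0 : r = 0 → k = 1) : GG k t ≤ GG k r := by
  have hcont : Continuous (GG k) := continuous_iff_continuousAt.2 fun x => (GG_deriv k x).continuousAt
  have hdiff : Differentiable ℝ (GG k) := fun x => (GG_deriv k x).differentiableAt
  rcases hr.eq_or_lt with h0 | h0
  · subst h0
    have hk1 := hk0 rfl
    subst hk1
    have : AntitoneOn (GG 1) (Set.Ici 0) := by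
      apply antitoneOn_of_deriv_nonpos (convex_Ici 0) hcont.continuousOn hdiff.differentiableOn
      intro x hx
      simp only [interior_Ici, Set.mem_Ioi] at hx
      rw [(GG_deriv 1 x).deriv]
      have := Real.self_le_sinh_iff.2 hx.le
      apply div_nonpos_of_nonpos_of_nonneg <;> [linarith; positivity]
    exact this (by simp) ht ht
  · have hs : 0 < Real.sinh r := Real.sinh_pos_iff.2 h0
    have hk' : k = r / Real.sinh r := by field_simp; exact hk
    rcases le_total t r with htr | htr
    · have : MonotoneOn (GG k) (Set.Icc 0 r) := by
        apply monotoneOn_of_deriv_nonneg (convex_Icc 0 r) hcont.continuousOn hdiff.differentiableOn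
        intro x hx
        simp only [interior_Icc, Set.mem_Ioo] at hx
        rw [(GG_deriv k x).deriv]
        have := sinh_scale hx.1.le hx.2.le h0
        have h3 : k * Real.sinh x ≤ x := by
          rw [hk', div_mul_eq_mul_div, div_le_iff₀ hs]; exact this
        apply div_nonneg <;> [linarith; positivity]
      exact this ⟨ht, htr⟩ ⟨hr, le_rfl⟩ htr
    · have : AntitoneOn (GG k) (Set.Ici r) := by
        apply antitoneOn_of_deriv_nonpos (convex_Ici r) hcont.continuousOn hdiff.differentiableOn
        intro x hx
        simp only [interior_Ici, Set.mem_Ioi] at hx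
        rw [(GG_deriv k x).deriv]
        have := sinh_scale hr hx.le (h0.trans hx)
        have h3 : x ≤ k * Real.sinh x := by
          rw [hk', div_mul_eq_mul_div, le_div_iff₀ hs]; exact this
        apply div_nonpos_of_nonpos_of_nonneg <;> [linarith; positivity]
      exact this (by simp) htr htr

lemma GG_le {k r t : ℝ} (hk : k * Real.sinh r = r)
    (hk0 : r = 0 → k = 1) : GG k t ≤ GG k r := by
  have habs : ∀ s, GG k |s| = GG k s := by
    intro s
    rcases abs_choice s with h | h <;> rw [h]
    exact GG_even k s
  rw [← habs t, ← habs r]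
  apply GG_le_pos (abs_nonneg _) (abs_nonneg _)
  · rcases abs_choice r with h | h <;> rw [h]
    · exact hk
    · rw [Real.sinh_neg]; linarith
  · intro h; exact hk0 (abs_eq_zero.1 h)

-- two-point in hyperbolic form
lemma two_point_hyp {k r t : ℝ} (hk : k * Real.sinh r = r)
    (hk0 : r = 0 → k = 1) :
    Real.log (Real.cosh r) - Real.log (Real.cosh t) - (r - t) * (Real.sinh t / Real.cosh t)
      ≤ k * (Real.cosh (r - t) - 1) / Real.cosh t := by
  have h := GG_le (t := t) hk hk0
  unfold GG at h
  have hct := Real.cosh_pos t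
  have hcr := Real.cosh_pos r
  have h1 : r * (Real.sinh r / Real.cosh r) + k / Real.cosh r = k * Real.cosh r := by
    nth_rewrite 1 [← hk]
    field_simp
    linear_combination (-k) * Real.cosh_sq r
  have h2 : k * (Real.cosh (r - t) - 1) / Real.cosh t
      = k * Real.cosh r - r * (Real.sinh t / Real.cosh t) - k / Real.cosh t := by
    rw [Real.cosh_sub]
    field_simp
    linear_combination (-Real.sinh t) * hk
  rw [h2]
  linarith

lemma cLS_hyp {p : ℝ} (h0 : 0 < p) (h1 : p < 1) : ∃ k r : ℝ, k * Real.sinh r = r ∧ (r = 0 → k = 1) ∧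
    cLS p = 2 * k * Real.cosh r ∧ p = Real.exp (-r) / (2 * Real.cosh r) ∧
    1 - p = Real.exp r / (2 * Real.cosh r) := by
  have hq : 0 < 1 - p := by linarith
  set r := (Real.log (1 - p) - Real.log p) / 2 with hr
  have hE : Real.exp r * Real.exp r * p = 1 - p := by
    rw [← Real.exp_add, show r + r = Real.log (1-p) - Real.log p by rw [hr]; ring, Real.exp_sub,
      Real.exp_log hq, Real.exp_log h0]
    field_simp
  have hc : 2 * Real.cosh r = Real.exp r + Real.exp (-r) := by rw [Real.cosh_eq]; ring
  have hs : 2 * Real.sinh r = Real.exp r - Real.exp (-r) := by rw [Real.sinh_eq]; ring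
  have hi : Real.exp r * Real.exp (-r) = 1 := by rw [← Real.exp_add]; simp
  have hcp := Real.cosh_pos r
  have hp' : p * (2 * Real.cosh r) = Real.exp (-r) := by
    rw [hc]
    have := Real.exp_pos (-r)
    linear_combination Real.exp (-r) * hE + (-p * Real.exp r) * hi
  have hq' : (1 - p) * (2 * Real.cosh r) = Real.exp r := by
    linear_combination hc - hp'
  have hp2 : p = Real.exp (-r) / (2 * Real.cosh r) := by rw [eq_div_iff (by positivity)]; exact hp'
  have hq2 : 1 - p = Real.exp r / (2 * Real.cosh r) := by rw [eq_div_iff (by positivity)]; exact hq'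
  by_cases hph : p = 1 / 2
  · have hr0 : r = 0 := by rw [hr, hph]; norm_num
    refine ⟨1, r, by rw [hr0]; simp, fun _ => rfl, ?_, hp2, hq2⟩
    rw [hr0, cLS, if_pos hph]; simp
  · have h12 : (1 - 2 * p) * Real.cosh r = Real.sinh r := by
      linear_combination (hq' - hp' - hs) / 2
    have hne : 1 - 2 * p ≠ 0 := fun h => hph (by linarith)
    have hsne : Real.sinh r ≠ 0 := by rw [← h12]; exact mul_ne_zero hne hcp.ne'
    refine ⟨r / Real.sinh r, r, by field_simp, ?_, ?_, hp2, hq2⟩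
    · intro h; rw [h] at hsne; simp at hsne
    · rw [cLS, if_neg hph, show Real.log (1 - p) - Real.log p = 2 * r by rw [hr]; ring, ← h12]
      field_simp

lemma two_point_pos {p : ℝ} (h0 : 0 < p) (h1 : p < 1) {a b : ℝ} (ha : 0 < a) (hb : 0 < b) :
    p * (a ^ 2 * Real.log (a ^ 2)) + (1 - p) * (b ^ 2 * Real.log (b ^ 2)) -
      (p * a ^ 2 + (1 - p) * b ^ 2) * Real.log (p * a ^ 2 + (1 - p) * b ^ 2)
    ≤ cLS p * (p * (1 - p)) * (a - b) ^ 2 := by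
  obtain ⟨k, r, hk, hk0, hcl, hp, hq⟩ := cLS_hyp h0 h1
  obtain ⟨l, rfl⟩ : ∃ l, Real.exp l = a := ⟨Real.log a, Real.exp_log ha⟩
  obtain ⟨m, rfl⟩ : ∃ m, Real.exp m = b := ⟨Real.log b, Real.exp_log hb⟩
  obtain ⟨t, rfl⟩ : ∃ t, m = t - r + l := ⟨m - l + r, by ring⟩
  have hcr := Real.cosh_pos r
  have hct := Real.cosh_pos t
  have hM : 0 < Real.exp (2 * l + t - r) / Real.cosh r := by positivity
  set M := Real.exp (2 * l + t - r) / Real.cosh r with hMdef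
  have hA : p * Real.exp l ^ 2 = M * Real.exp (-t) / 2 := by
    rw [hp, hMdef, ← Real.exp_nat_mul, div_mul_eq_mul_div, ← Real.exp_add, div_mul_eq_mul_div,
      ← Real.exp_add, div_div, mul_comm 2]
    congr 2; push_cast; ring
  have hB : (1 - p) * Real.exp (t - r + l) ^ 2 = M * Real.exp t / 2 := by
    rw [hq, hMdef, ← Real.exp_nat_mul, div_mul_eq_mul_div, ← Real.exp_add, div_mul_eq_mul_div,
      ← Real.exp_add, div_div, mul_comm 2]
    congr 2; push_cast; ring
  have hS : p * Real.exp l ^ 2 + (1 - p) * Real.exp (t - r + l) ^ 2 = M * Real.cosh t := by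
    rw [hA, hB, Real.cosh_eq]; ring
  have hlogS : Real.log (M * Real.cosh t) = 2 * l + t - r - Real.log (Real.cosh r)
      + Real.log (Real.cosh t) := by
    rw [Real.log_mul hM.ne' hct.ne', hMdef, Real.log_div (by positivity) hcr.ne', Real.log_exp]
  have hR : cLS p * (p * (1 - p)) * (Real.exp l - Real.exp (t - r + l)) ^ 2
      = M * (k * (Real.cosh (r - t) - 1)) := by
    have e1 : Real.exp (t - r + l) = Real.exp t * Real.exp (-r) * Real.exp l := by
      rw [← Real.exp_add, ← Real.exp_add]; congr 1
    have e2 : Real.exp (2 * l + t - r) = Real.exp l * Real.exp l * Real.exp t * Real.exp (-r) := by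
      rw [← Real.exp_add, ← Real.exp_add, ← Real.exp_add]; congr 1; ring
    have e3 : Real.cosh (r - t) = (Real.exp r * Real.exp (-t) + Real.exp t * Real.exp (-r)) / 2 := by
      rw [Real.cosh_eq, ← Real.exp_add, ← Real.exp_add]; congr 3; ring
    have i1 : Real.exp r * Real.exp (-r) = 1 := by rw [← Real.exp_add]; simp
    have i2 : Real.exp t * Real.exp (-t) = 1 := by rw [← Real.exp_add]; simp
    have hpq : p * (1 - p) = 1 / (4 * Real.cosh r ^ 2) := by
      rw [hq]; nth_rewrite 1 [hp]; field_simp; linear_combination 4 * i1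
    rw [hcl, hpq, hMdef, e1, e2, e3]
    generalize Real.exp t = T at *
    generalize Real.exp (-t) = T' at *
    generalize Real.exp r = R at *
    generalize Real.exp (-r) = R' at *
    generalize Real.exp l = Y at *
    field_simp
    linear_combination (- 4 * k * T * T') * i1 - 4 * k * i2
  have hl1 : Real.log (Real.exp l ^ 2) = 2 * l := by rw [Real.log_pow, Real.log_exp]; norm_num
  have hl2 : Real.log (Real.exp (t - r + l) ^ 2) = 2 * (t - r + l) := by
    rw [Real.log_pow, Real.log_exp]; norm_num
  rw [hR, hS, hlogS, hl1, hl2, ← mul_assoc p, ← mul_assoc (1 - p), hA, hB]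
  have hh := two_point_hyp (t := t) hk hk0
  rw [le_div_iff₀ hct] at hh
  refine le_trans (le_of_eq ?_) (mul_le_mul_of_nonneg_left hh hM.le)
  have e1 : Real.exp t = Real.cosh t + Real.sinh t := (Real.cosh_add_sinh t).symm
  have e2 : Real.exp (-t) = Real.cosh t - Real.sinh t := (Real.cosh_sub_sinh t).symm
  rw [e1, e2]
  field_simp
  ring

lemma two_point {p : ℝ} (h0 : 0 < p) (h1 : p < 1) {a b : ℝ} (ha : 0 ≤ a) (hb : 0 ≤ b) :
    p * (a ^ 2 * Real.log (a ^ 2)) + (1 - p) * (b ^ 2 * Real.log (b ^ 2)) -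
      (p * a ^ 2 + (1 - p) * b ^ 2) * Real.log (p * a ^ 2 + (1 - p) * b ^ 2)
    ≤ cLS p * (p * (1 - p)) * (a - b) ^ 2 := by
  have hc : ∀ f : ℝ → ℝ, Continuous f → Continuous fun x => f x * Real.log (f x) :=
    fun f hf => Real.continuous_mul_log.comp hf
  have key : ∀ e ∈ Set.Ioi (0:ℝ),
    p * ((a + e) ^ 2 * Real.log ((a + e) ^ 2)) + (1 - p) * ((b + e) ^ 2 * Real.log ((b + e) ^ 2)) -
      (p * (a + e) ^ 2 + (1 - p) * (b + e) ^ 2) * Real.log (p * (a + e) ^ 2 + (1 - p) * (b + e) ^ 2)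
    ≤ cLS p * (p * (1 - p)) * ((a + e) - (b + e)) ^ 2 := by
    intro e he
    have he' : 0 < e := he
    exact two_point_pos h0 h1 (by linarith) (by linarith)
  have hcl : IsClosed {e : ℝ | p * ((a + e) ^ 2 * Real.log ((a + e) ^ 2)) + (1 - p) * ((b + e) ^ 2 * Real.log ((b + e) ^ 2)) -
      (p * (a + e) ^ 2 + (1 - p) * (b + e) ^ 2) * Real.log (p * (a + e) ^ 2 + (1 - p) * (b + e) ^ 2)
    ≤ cLS p * (p * (1 - p)) * ((a + e) - (b + e)) ^ 2} := by
    apply isClosed_le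
    · exact ((continuous_const.mul (hc _ (by fun_prop))).add
        (continuous_const.mul (hc _ (by fun_prop)))).sub (hc _ (by fun_prop))
    · fun_prop
  have h2 := hcl.closure_subset_iff.2 key (by rw [closure_Ioi]; simp : (0:ℝ) ∈ closure (Set.Ioi 0))
  simpa using h2

lemma cLS_ge_two {p : ℝ} (h0 : 0 < p) (h1 : p < 1) : 2 ≤ cLS p := by
  have key : ∀ q : ℝ, 0 < q → q < 1 / 2 → 2 * (1 - 2 * q) ≤ Real.log (1 - q) - Real.log q := by
    intro q hq hq2
    have h := Real.le_log_one_add_of_nonneg (x := (1 - 2 * q) / q) (by apply div_nonneg <;> linarith)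
    rw [show 1 + (1 - 2 * q) / q = (1 - q) / q by field_simp; ring,
      Real.log_div (by linarith) hq.ne'] at h
    refine le_trans (le_of_eq ?_) h
    have : (1 - 2 * q) / q + 2 = 1 / q := by field_simp; ring
    rw [this]; field_simp
  unfold cLS
  split_ifs with h
  · exact le_rfl
  · rcases lt_or_gt_of_ne h with h | h
    · rw [le_div_iff₀ (by linarith)]; exact key p h0 h
    · rw [le_div_iff_of_neg (by linarith)]
      have := key (1 - p) (by linarith) (by linarith)
      rw [show 1 - (1 - p) = p by ring] at this
      linarith

lemma muE_succ (n : ℕ) (p : ℝ) (f : (Fin (n+1) → Bool) → ℝ) :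
    muE (n+1) p f = p * muE n p (fun y => f (Fin.cons true y)) +
      (1 - p) * muE n p (fun y => f (Fin.cons false y)) := by
  unfold muE
  rw [← (Fin.consEquiv (fun _ : Fin (n+1) => Bool)).sum_comp, Fintype.sum_prod_type,
    Fintype.sum_bool, Finset.mul_sum, Finset.mul_sum]
  congr 1 <;> (apply Finset.sum_congr rfl; intro y _; simp [muW, Fin.prod_univ_succ, Fin.consEquiv, mul_assoc])

lemma muE_zero (p : ℝ) (f : (Fin 0 → Bool) → ℝ) : muE 0 p f = f default := by
  unfold muE muW
  rw [Fintype.sum_unique]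
  simp only [Finset.univ_eq_empty, Finset.prod_empty, one_mul]
  exact congrArg f (Subsingleton.elim _ _)

lemma muE_add (n : ℕ) (p : ℝ) (f g : (Fin n → Bool) → ℝ) :
    muE n p (fun x => f x + g x) = muE n p f + muE n p g := by
  simp [muE, mul_add, Finset.sum_add_distrib]

lemma muE_smul (n : ℕ) (p c : ℝ) (f : (Fin n → Bool) → ℝ) :
    muE n p (fun x => c * f x) = c * muE n p f := by
  simp only [muE, Finset.mul_sum]
  exact Finset.sum_congr rfl fun x _ => by ring

lemma muW_nonneg (n : ℕ) {p : ℝ} (h0 : 0 < p) (h1 : p < 1) (x : Fin n → Bool) : 0 ≤ muW n p x := by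
  apply Finset.prod_nonneg
  intro i _
  split_ifs <;> linarith

lemma muE_mono (n : ℕ) {p : ℝ} (h0 : 0 < p) (h1 : p < 1) {f g : (Fin n → Bool) → ℝ}
    (h : ∀ x, f x ≤ g x) : muE n p f ≤ muE n p g :=
  Finset.sum_le_sum fun x _ => mul_le_mul_of_nonneg_left (h x) (muW_nonneg n h0 h1 x)

lemma muE_nonneg (n : ℕ) {p : ℝ} (h0 : 0 < p) (h1 : p < 1) {f : (Fin n → Bool) → ℝ}
    (h : ∀ x, 0 ≤ f x) : 0 ≤ muE n p f :=
  Finset.sum_nonneg fun x _ => mul_nonneg (muW_nonneg n h0 h1 x) (h x)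

lemma muE_one (n : ℕ) (p : ℝ) : muE n p (fun _ => 1) = 1 := by
  induction n with
  | zero => simp [muE_zero]
  | succ n ih => rw [muE_succ, ih]; ring

lemma grad_zero (n : ℕ) (f : (Fin (n+1) → Bool) → ℝ) (b : Bool) (y : Fin n → Bool) :
    grad (n+1) 0 f (Fin.cons b y) = f (Fin.cons true y) - f (Fin.cons false y) := by
  simp [grad, Fin.update_cons_zero]

lemma grad_succ (n : ℕ) (f : (Fin (n+1) → Bool) → ℝ) (j : Fin n) (b : Bool) (y : Fin n → Bool) :
    grad (n+1) j.succ f (Fin.cons b y) = grad n j (fun z => f (Fin.cons b z)) y := by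
  simp [grad, Fin.cons_update]

/-- Unnormalised energy. -/
noncomputable def Enr (n : ℕ) (p : ℝ) (f : (Fin n → Bool) → ℝ) : ℝ :=
  ∑ i, muE n p (fun x => grad n i f x ^ 2)

lemma Enr_succ (n : ℕ) (p : ℝ) (f : (Fin (n+1) → Bool) → ℝ) :
    Enr (n+1) p f = muE n p (fun y => (f (Fin.cons true y) - f (Fin.cons false y)) ^ 2)
      + p * Enr n p (fun y => f (Fin.cons true y)) + (1 - p) * Enr n p (fun y => f (Fin.cons false y)) := by
  unfold Enr
  rw [Fin.sum_univ_succ, muE_succ]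
  simp only [muE_succ n p (fun x => grad (n+1) (Fin.succ _) f x ^ 2), grad_zero, grad_succ]
  rw [Finset.sum_add_distrib, Finset.mul_sum, Finset.mul_sum]
  ring

lemma Enr_zero (p : ℝ) (f : (Fin 0 → Bool) → ℝ) : Enr 0 p f = 0 := by simp [Enr]

/-- Reverse triangle inequality in L². -/
lemma sqrt_sub_sq_le (n : ℕ) {p : ℝ} (h0 : 0 < p) (h1 : p < 1) (f g : (Fin n → Bool) → ℝ) :
    (√(muE n p fun x => f x ^ 2) - √(muE n p fun x => g x ^ 2)) ^ 2
      ≤ muE n p fun x => (f x - g x) ^ 2 := by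
  have hf : 0 ≤ muE n p fun x => f x ^ 2 := muE_nonneg n h0 h1 fun x => sq_nonneg _
  have hg : 0 ≤ muE n p fun x => g x ^ 2 := muE_nonneg n h0 h1 fun x => sq_nonneg _
  have hexp : (muE n p fun x => (f x - g x) ^ 2) =
      (muE n p fun x => f x ^ 2) + (muE n p fun x => g x ^ 2) - 2 * muE n p fun x => f x * g x := by
    simp only [muE, Finset.mul_sum, ← Finset.sum_add_distrib, ← Finset.sum_sub_distrib]
    exact Finset.sum_congr rfl fun x _ => by ring
  have hcs : (muE n p fun x => f x * g x) ^ 2 ≤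
      (muE n p fun x => f x ^ 2) * (muE n p fun x => g x ^ 2) := by
    have := Finset.sum_mul_sq_le_sq_mul_sq Finset.univ (fun x => √(muW n p x) * f x)
      (fun x => √(muW n p x) * g x)
    have hw : ∀ x, √(muW n p x) ^ 2 = muW n p x := fun x => Real.sq_sqrt (muW_nonneg n h0 h1 x)
    simp only [mul_pow, hw] at this
    refine le_trans (le_of_eq ?_) this
    unfold muE
    congr 1
    apply Finset.sum_congr rfl
    intro x _
    linear_combination (-(f x * g x)) * hw x
  have h3 : (muE n p fun x => f x * g x) ≤ √(muE n p fun x => f x ^ 2) * √(muE n p fun x => g x ^ 2) := by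
    rw [← Real.sqrt_mul hf]
    exact Real.le_sqrt_of_sq_le hcs
  rw [hexp]
  nlinarith [Real.sq_sqrt hf, Real.sq_sqrt hg]

lemma log_sobolev (n : ℕ) {p : ℝ} (h0 : 0 < p) (h1 : p < 1) (f : (Fin n → Bool) → ℝ) :
    ent n p (fun x => f x ^ 2) ≤ cLS p * (p * (1 - p)) * Enr n p f := by
  induction n with
  | zero => simp [ent, muE_zero, Enr_zero]
  | succ n ih =>
    have i1 := ih (fun y => f (Fin.cons true y))
    have i0 := ih (fun y => f (Fin.cons false y))
    have hc := cLS_ge_two h0 h1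
    have hq : 0 < 1 - p := by linarith
    have hf : 0 ≤ muE n p fun y => f (Fin.cons true y) ^ 2 := muE_nonneg n h0 h1 fun x => sq_nonneg _
    have hg : 0 ≤ muE n p fun y => f (Fin.cons false y) ^ 2 := muE_nonneg n h0 h1 fun x => sq_nonneg _
    have h2 := two_point h0 h1 (Real.sqrt_nonneg (muE n p fun y => f (Fin.cons true y) ^ 2))
      (Real.sqrt_nonneg (muE n p fun y => f (Fin.cons false y) ^ 2))
    have h3 := mul_le_mul_of_nonneg_left (sqrt_sub_sq_le n h0 h1 (fun y => f (Fin.cons true y))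
      (fun y => f (Fin.cons false y))) (show 0 ≤ cLS p * (p * (1 - p)) by positivity)
    rw [Real.sq_sqrt hf, Real.sq_sqrt hg] at h2
    rw [Enr_succ]
    unfold ent at *
    rw [muE_succ, muE_succ]
    have j1 := mul_le_mul_of_nonneg_left i1 h0.le
    have j0 := mul_le_mul_of_nonneg_left i0 hq.le
    linarith

/-- `x log x`-type tangent inequality. -/
lemma tangent {x k : ℝ} (hx : 0 ≤ x) (hk : 0 < k) :
    x * (1 + Real.log k) - k ≤ x * Real.log x := by
  rcases hx.eq_or_lt with h | h
  · subst h; simp [hk.le]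
  · have h1 := Real.one_sub_inv_le_log_of_pos (show 0 < x / k by positivity)
    rw [Real.log_div h.ne' hk.ne', inv_div] at h1
    have := mul_le_mul_of_nonneg_left h1 hx
    have e : x * (1 - k / x) = x - k := by field_simp
    linarith

lemma ent_lower (n : ℕ) {p : ℝ} (h0 : 0 < p) (h1 : p < 1) (g : (Fin n → Bool) → ℝ) {lam b : ℝ}
    (hl : 0 < lam) (hb : muE n p (fun x => |g x|) ≤ b) :
    muE n p (fun x => g x ^ 2) * (1 + Real.log lam) - lam * b ^ 2 ≤ ent n p (fun x => g x ^ 2) := by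
  unfold ent
  set V := muE n p (fun x => g x ^ 2) with hV
  set m := muE n p (fun x => |g x|) with hm
  have hm0 : 0 ≤ m := muE_nonneg n h0 h1 fun x => abs_nonneg _
  have hV0 : 0 ≤ V := muE_nonneg n h0 h1 fun x => sq_nonneg _
  have key : ∀ k : ℝ, 0 < k → 2 * (V * (1 + Real.log k) - k * m) ≤
      muE n p (fun x => g x ^ 2 * Real.log (g x ^ 2)) := by
    intro k hk
    have : muE n p (fun x => (2 * (1 + Real.log k)) * g x ^ 2 + (-(2 * k)) * |g x|) ≤
        muE n p (fun x => g x ^ 2 * Real.log (g x ^ 2)) := by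
      apply muE_mono n h0 h1
      intro x
      have h := mul_le_mul_of_nonneg_left (tangent (abs_nonneg (g x)) hk) (abs_nonneg (g x))
      rw [Real.log_pow, ← Real.log_abs (g x), ← sq_abs]
      push_cast
      linarith
    rw [muE_add, muE_smul, muE_smul] at this
    linarith
  have hb2 : lam * m ^ 2 ≤ lam * b ^ 2 := by gcongr
  rcases hV0.eq_or_lt with h | h
  · rw [← h] at key ⊢
    have hm' : m = 0 := by
      have : (m : ℝ) ^ 2 ≤ 0 := by
        have hs := sqrt_sub_sq_le n h0 h1 g (fun _ => 0)
        by_contra hcon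
        push Not at hcon
        have hmp : 0 < m := by
          rcases hm0.eq_or_lt with h' | h'
          · rw [← h'] at hcon; norm_num at hcon
          · exact h'
        have : muE n p (fun x => m * |g x| ) ≤ muE n p (fun x => g x ^ 2 + m^2 / 4 * 1) := by
          apply muE_mono n h0 h1
          intro x
          nlinarith [sq_nonneg (|g x| - m / 2), sq_abs (g x)]
        rw [muE_smul, muE_add, muE_smul, muE_one, ← hV, ← hm, ← h] at this
        nlinarith
      nlinarith
    have := key 1 one_pos
    rw [hm'] at this
    simp at this ⊢
    nlinarith [mul_nonneg hl.le (sq_nonneg b)]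
  · have hmp : 0 < m := by
      rcases hm0.eq_or_lt with h' | h'
      · exfalso
        have hz : ∀ x ∈ Finset.univ, muW n p x * |g x| = 0 :=
          (Finset.sum_eq_zero_iff_of_nonneg fun x _ =>
            mul_nonneg (muW_nonneg n h0 h1 x) (abs_nonneg _)).1 h'.symm
        have : V = 0 := by
          apply Finset.sum_eq_zero
          intro x hx
          have := hz x hx
          show muW n p x * g x ^ 2 = 0
          rw [← sq_abs]
          linear_combination |g x| * this
        linarith
      · exact h'
    have h2 := key (V / m) (by positivity)
    have h3 := tangent (x := V / m ^ 2) (k := lam) (by positivity) hl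
    have h4 := mul_le_mul_of_nonneg_right h3 (sq_nonneg m)
    rw [Real.log_div h.ne' hmp.ne', div_mul_cancel₀ _ hmp.ne'] at h2
    rw [Real.log_div h.ne' (by positivity), Real.log_pow] at h4
    have e1 : (V / m ^ 2 * (1 + Real.log lam) - lam) * m ^ 2 = V * (1 + Real.log lam) - lam * m ^ 2 := by
      field_simp
    have e2 : V / m ^ 2 * (Real.log V - ((2:ℕ):ℝ) * Real.log m) * m ^ 2
        = V * (Real.log V - 2 * Real.log m) := by
      push_cast; field_simp
    rw [e1, e2] at h4
    linarith

lemma Enr_avg (n : ℕ) (p : ℝ) (f g : (Fin n → Bool) → ℝ) :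
    p * Enr n p f + (1 - p) * Enr n p g = Enr n p (fun x => p * f x + (1 - p) * g x)
      + p * (1 - p) * Enr n p (fun x => f x - g x) := by
  simp only [Enr, muE, Finset.mul_sum, ← Finset.sum_add_distrib]
  refine Finset.sum_congr rfl fun i _ => Finset.sum_congr rfl fun x _ => ?_
  simp only [grad]
  ring

lemma Enr_smul (n : ℕ) (p c : ℝ) (f : (Fin n → Bool) → ℝ) :
    Enr n p (fun x => c * f x) = c ^ 2 * Enr n p f := by
  simp only [Enr, muE, Finset.mul_sum]
  refine Finset.sum_congr rfl fun i _ => Finset.sum_congr rfl fun x _ => ?_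
  simp only [grad]
  ring

lemma Enr_nonneg (n : ℕ) {p : ℝ} (h0 : 0 < p) (h1 : p < 1) (f : (Fin n → Bool) → ℝ) :
    0 ≤ Enr n p f :=
  Finset.sum_nonneg fun _ _ => muE_nonneg n h0 h1 fun _ => sq_nonneg _

lemma varE_succ (n : ℕ) (p : ℝ) (f : (Fin (n+1) → Bool) → ℝ) :
    varE (n+1) p f = varE n p (fun y => p * f (Fin.cons true y) + (1 - p) * f (Fin.cons false y))
      + p * (1 - p) * muE n p (fun y => (f (Fin.cons true y) - f (Fin.cons false y)) ^ 2) := by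
  unfold varE
  rw [muE_succ, muE_succ]
  rw [muE_add n p (fun y => p * f (Fin.cons true y)), muE_smul, muE_smul]
  have : p * muE n p (fun y => f (Fin.cons true y) ^ 2) + (1 - p) * muE n p (fun y => f (Fin.cons false y) ^ 2)
    = muE n p (fun y => (p * f (Fin.cons true y) + (1 - p) * f (Fin.cons false y)) ^ 2) +
    p * (1 - p) * muE n p (fun y => (f (Fin.cons true y) - f (Fin.cons false y)) ^ 2) := by
    simp only [muE, Finset.mul_sum, ← Finset.sum_add_distrib]
    exact Finset.sum_congr rfl fun x _ => by ring
  rw [this]; ring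

lemma poincare (n : ℕ) {p : ℝ} (h0 : 0 < p) (h1 : p < 1) (f : (Fin n → Bool) → ℝ) :
    varE n p f ≤ p * (1 - p) * Enr n p f := by
  have hq : 0 < 1 - p := by linarith
  induction n with
  | zero => simp [varE, muE_zero, Enr_zero]
  | succ n ih =>
    have h := ih (fun y => p * f (Fin.cons true y) + (1 - p) * f (Fin.cons false y))
    have h2 := Enr_avg n p (fun y => f (Fin.cons true y)) (fun y => f (Fin.cons false y))
    have h3 : 0 ≤ p * (1 - p) * (p * (1 - p) * Enr n p (fun y => f (Fin.cons true y) - f (Fin.cons false y))) := by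
      have := Enr_nonneg n h0 h1 (fun y => f (Fin.cons true y) - f (Fin.cons false y))
      positivity
    rw [varE_succ, Enr_succ, add_assoc, h2]
    linarith

lemma main_ineq (n : ℕ) {p : ℝ} (h0 : 0 < p) (h1 : p < 1) (f : (Fin n → Bool) → ℝ) {lam b : ℝ}
    (hl : 0 < lam) (hb : ∀ j, 2 * (p * (1 - p)) * muE n p (fun x => |grad n j f x|) ≤ b) :
    varE n p f * (1 + Real.log lam) ≤ cLS p * (p * (1 - p)) * Enr n p f + n * (lam * b ^ 2) := by
  have hq : 0 < 1 - p := by linarith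
  induction n with
  | zero => simp [varE, muE_zero, Enr_zero]
  | succ n ih =>
    have h := ih (fun y => p * f (Fin.cons true y) + (1 - p) * f (Fin.cons false y)) (by
      intro j
      refine le_trans ?_ (hb j.succ)
      apply mul_le_mul_of_nonneg_left _ (by positivity)
      rw [muE_succ, ← muE_smul, ← muE_smul, ← muE_add]
      apply muE_mono n h0 h1
      intro y
      rw [grad_succ, grad_succ]
      have e : grad n j (fun y => p * f (Fin.cons true y) + (1 - p) * f (Fin.cons false y)) y
        = p * grad n j (fun y => f (Fin.cons true y)) y + (1 - p) * grad n j (fun y => f (Fin.cons false y)) y := by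
        simp only [grad]; ring
      rw [e]
      refine (abs_add_le _ _).trans ?_
      rw [abs_mul, abs_mul, abs_of_pos h0, abs_of_pos hq])
    have h2 := Enr_avg n p (fun y => f (Fin.cons true y)) (fun y => f (Fin.cons false y))
    -- the function `Δ₀ f`
    let g : (Fin (n+1) → Bool) → ℝ := fun x =>
      (if x 0 then 1 - p else -p) * (f (Fin.cons true (Fin.tail x)) - f (Fin.cons false (Fin.tail x)))
    have g1 : ∀ y, g (Fin.cons true y) = (1 - p) * (f (Fin.cons true y) - f (Fin.cons false y)) := by
      intro y; simp [g]
    have g0 : ∀ y, g (Fin.cons false y) = (-p) * (f (Fin.cons true y) - f (Fin.cons false y)) := by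
      intro y; simp [g]
    have hls := log_sobolev (n+1) h0 h1 g
    have hgabs : muE (n+1) p (fun x => |g x|) ≤ b := by
      refine le_trans (le_of_eq ?_) (hb 0)
      rw [muE_succ, muE_succ]
      simp only [g1, g0, grad_zero, abs_mul, abs_neg, abs_of_pos h0, abs_of_pos hq, muE_smul]
      ring
    have hlow := ent_lower (n+1) h0 h1 g hl hgabs
    have hgsq : muE (n+1) p (fun x => g x ^ 2) =
        p * (1 - p) * muE n p (fun y => (f (Fin.cons true y) - f (Fin.cons false y)) ^ 2) := by
      rw [muE_succ]
      simp only [g1, g0, mul_pow, muE_smul]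
      ring
    have hgE : Enr (n+1) p g = muE n p (fun y => (f (Fin.cons true y) - f (Fin.cons false y)) ^ 2)
        + p * (1 - p) * Enr n p (fun y => f (Fin.cons true y) - f (Fin.cons false y)) := by
      rw [Enr_succ]
      simp only [g1, g0, Enr_smul]
      have : ∀ y : Fin n → Bool, (1 - p) * (f (Fin.cons true y) - f (Fin.cons false y)) -
        -p * (f (Fin.cons true y) - f (Fin.cons false y)) = f (Fin.cons true y) - f (Fin.cons false y) :=
        fun y => by ring
      simp only [this]
      ring
    rw [hgsq] at hlow
    rw [hgE] at hls
    rw [varE_succ, Enr_succ, add_assoc, h2]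
    push_cast
    linarith

lemma russo (n : ℕ) (p : ℝ) (f : (Fin n → Bool) → ℝ) :
    HasDerivAt (fun q => muE n q f) (∑ i, muE n p (fun x => grad n i f x)) p := by
  induction n with
  | zero => simpa [muE_zero] using hasDerivAt_const p (f default)
  | succ n ih =>
    have i1 := ih (fun y => f (Fin.cons true y))
    have i0 := ih (fun y => f (Fin.cons false y))
    have h := ((hasDerivAt_id p).mul i1).add (((hasDerivAt_id p).const_sub 1).mul i0)
    have e : (fun q => muE (n+1) q f) = fun q => id q * muE n q (fun y => f (Fin.cons true y)) +
        (1 - id q) * muE n q (fun y => f (Fin.cons false y)) := by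
      funext q; rw [muE_succ]; rfl
    rw [e]
    refine HasDerivAt.congr_deriv h ?_
    rw [Fin.sum_univ_succ, muE_succ]
    simp only [muE_succ n p (fun x => grad (n+1) (Fin.succ _) f x), grad_zero, grad_succ]
    rw [Finset.sum_add_distrib, ← Finset.mul_sum, ← Finset.mul_sum]
    have : muE n p (fun y => f (Fin.cons true y) - f (Fin.cons false y)) =
      muE n p (fun y => f (Fin.cons true y)) - muE n p (fun y => f (Fin.cons false y)) := by
      simp [muE, mul_sub, Finset.sum_sub_distrib]
    simp only [this, id]
    ring

lemma muE_perm (n : ℕ) (p : ℝ) (g : Equiv.Perm (Fin n)) (f : (Fin n → Bool) → ℝ) :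
    muE n p (fun x => f (fun i => x (g i))) = muE n p f := by
  unfold muE
  rw [← (Equiv.arrowCongr g.symm (Equiv.refl Bool)).sum_comp (fun x => muW n p x * f x)]
  apply Finset.sum_congr rfl
  intro x _
  have h1 : (Equiv.arrowCongr g.symm (Equiv.refl Bool)) x = fun i => x (g i) := by
    funext i; simp [Equiv.arrowCongr]
  rw [h1]
  congr 1
  unfold muW
  exact (Equiv.prod_comp g (fun i => if x i then p else 1 - p)).symm

lemma grad_sym (n : ℕ) (p : ℝ) (g : Equiv.Perm (Fin n)) (f : (Fin n → Bool) → ℝ)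
    (hf : ∀ x, f (fun i => x (g i)) = f x) (j : Fin n) :
    muE n p (fun x => grad n (g j) f x) = muE n p (fun x => grad n j f x) := by
  rw [← muE_perm n p g (fun x => grad n j f x)]
  congr 1
  funext x
  have hu : ∀ b, (fun i => Function.update x (g j) b (g i)) = Function.update (fun i => x (g i)) j b := by
    intro b; funext i
    simp [Function.update_apply]
  unfold grad
  rw [← hu, ← hu, hf, hf]

lemma sseq_le {n : ℕ} (hn : 2 ≤ n) {y : ℝ} (hy2 : 2 ≤ y)
    (hy : Real.log n - 2 * Real.log y ≤ y) : sseq n ≤ y := by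
  have hs : sseq n ≤ Real.log n - 2 * Real.log (Real.log n) := by
    unfold sseq
    exact sub_le_sub_left (le_max_right _ _) _
  refine hs.trans ?_
  rcases hn.eq_or_lt with h | h
  · subst h
    have h2 := Real.log_two_gt_d9
    have h3 := Real.log_two_lt_d9
    have hpos : 0 < Real.log 2 := by linarith
    have h4 := Real.one_sub_inv_le_log_of_pos hpos
    have h5 : (Real.log 2)⁻¹ ≤ 3 / 2 := by
      rw [inv_le_comm₀ hpos (by norm_num)]; linarith
    push_cast
    linarith
  · have hn3 : (3:ℝ) ≤ n := by exact_mod_cast h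
    have hl1 : 1 ≤ Real.log n := by
      rw [Real.le_log_iff_exp_le (by linarith)]
      have := Real.exp_one_lt_d9
      linarith
    by_contra hcon
    push Not at hcon
    have hll := Real.log_nonneg hl1
    have : Real.log y ≤ Real.log (Real.log n) := Real.log_le_log (by linarith) (by linarith)
    linarith

/-- Theorem 4.1: for every `n ≥ 2`, `p ∈ (0,1)` and every nontrivial
monotone symmetric `A ⊆ {0,1}^n`,
`dμ_p(A)/dp ≥ (s(n)/(p(1-p) c_LS(p))) μ_p(A)(1-μ_p(A))`. -/
theorem stmt15 (n : ℕ) (hn : 2 ≤ n) (p : ℝ) (hp : p ∈ Set.Ioo (0 : ℝ) 1)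
    (A : Finset (Fin n → Bool))
    (hmono : MonotoneSet n A) (hsym : SymmetricSet n A)
    (hne : A.Nonempty) (hnu : A ≠ Finset.univ) :
    deriv (fun q => muP n q A) p ≥
      sseq n / (p * (1 - p) * cLS p) * (muP n p A * (1 - muP n p A)) := by
  classical
  obtain ⟨h0, h1⟩ := hp
  have hq : 0 < 1 - p := by linarith
  let f : (Fin n → Bool) → ℝ := fun x => if x ∈ A then 1 else 0
  have hf : ∀ q, muP n q A = muE n q f := by
    intro q; simp [muP, muE, f]
  have hfsq : ∀ x, f x ^ 2 = f x := by
    intro x; simp only [f]; split_ifs <;> norm_num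
  have hf0 : ∀ x, 0 ≤ f x := by
    intro x; simp only [f]; split_ifs <;> norm_num
  have hf1 : ∀ x, f x ≤ 1 := by
    intro x; simp only [f]; split_ifs <;> norm_num
  have hgr : ∀ i x, grad n i f x = 0 ∨ grad n i f x = 1 := by
    intro i x
    have hm : Function.update x i false ∈ A → Function.update x i true ∈ A := by
      intro h
      apply hmono _ h
      intro k
      by_cases hk : k = i
      · subst hk; simp
      · simp [Function.update_of_ne hk]
    unfold grad
    by_cases ha : Function.update x i true ∈ A <;> by_cases hb : Function.update x i false ∈ A <;>
      simp [f, ha, hb]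
    exact (ha (hm hb)).elim
  have hgsq : ∀ i x, grad n i f x ^ 2 = grad n i f x := by
    intro i x; rcases hgr i x with h | h <;> rw [h] <;> norm_num
  have hgabs : ∀ i x, |grad n i f x| = grad n i f x := by
    intro i x; rcases hgr i x with h | h <;> rw [h] <;> norm_num
  -- symmetry
  obtain ⟨G, htr, hinv⟩ := hsym
  have hfin : ∀ g ∈ G, ∀ x, f (fun i => x (g i)) = f x := by
    intro g hg x
    have e : ((fun i => x (g i)) ∈ A) ↔ x ∈ A := by
      constructor
      · intro h
        have := hinv g hg _ h
        simpa using this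
      · intro h
        have := hinv g⁻¹ (G.inv_mem hg) _ h
        simpa using this
    simp only [f, e]
  have hI : ∀ i j, muE n p (fun x => grad n i f x) = muE n p (fun x => grad n j f x) := by
    intro i j
    obtain ⟨g, hg, rfl⟩ := htr j i
    exact grad_sym n p g f (hfin g hg) j
  have hderiv : deriv (fun q => muP n q A) p = ∑ i, muE n p (fun x => grad n i f x) := by
    simp only [hf]
    exact (russo n p f).deriv
  have hnpos : (0:ℝ) < n := by
    have : 0 < n := by omega
    exact_mod_cast this
  set D := ∑ i, muE n p (fun x => grad n i f x) with hD
  have hIj : ∀ j, muE n p (fun x => grad n j f x) = D / n := by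
    intro j
    rw [hD, Finset.sum_congr rfl fun i _ => hI i j]
    simp
    field_simp
  have hEn : Enr n p f = D := by simp only [Enr, hgsq, hD]
  rw [hderiv, hf]
  set u := muE n p f with hu
  have hu0 : 0 ≤ u := muE_nonneg n h0 h1 hf0
  have hu1 : u ≤ 1 := by
    rw [← muE_one n p]; exact muE_mono n h0 h1 hf1
  have hVar : varE n p f = u * (1 - u) := by
    simp only [varE, hfsq, ← hu]; ring
  have hpo := poincare n h0 h1 f
  have hmain := fun lam (hl : 0 < lam) => main_ineq n h0 h1 f (lam := lam)
    (b := 2 * (p * (1 - p)) * (D / n)) hl (by intro j; simp only [hgabs, hIj]; exact le_rfl)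
  rw [hVar, hEn] at hpo
  rw [hVar, hEn] at hmain
  have hV0 : 0 ≤ u * (1 - u) := mul_nonneg hu0 (by linarith)
  have hV1 : u * (1 - u) ≤ 1 := by nlinarith
  have hc := cLS_ge_two h0 h1
  have hc0 : 0 < cLS p := by linarith
  generalize u * (1 - u) = V at *
  have hP : 0 < p * (1 - p) := mul_pos h0 hq
  generalize p * (1 - p) = P at *
  generalize cLS p = c at *
  rcases hV0.eq_or_lt with hV | hV
  · rw [← hV] at hpo ⊢
    rw [mul_zero]
    exact nonneg_of_mul_nonneg_right hpo hP
  have hPD : 0 < P * D := hV.trans_le hpo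
  have hDpos : 0 < D := pos_of_mul_pos_right hPD hP.le
  have hy2 : 2 ≤ c * (P * D) / V := by
    rw [le_div_iff₀ hV]; nlinarith
  have hlog : Real.log n - 2 * Real.log (c * (P * D) / V) ≤ c * (P * D) / V := by
    have hb : 0 < 2 * P * (D / n) := by positivity
    have hm := hmain (V / (n * (2 * P * (D / n)) ^ 2)) (by positivity)
    have e : n * (V / (n * (2 * P * (D / n)) ^ 2) * (2 * P * (D / n)) ^ 2) = V := by field_simp
    rw [e] at hm
    have hm2 : Real.log (V / (n * (2 * P * (D / n)) ^ 2)) ≤ c * (P * D) / V := by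
      rw [le_div_iff₀ hV]; linarith
    have e2 : V / (n * (2 * P * (D / n)) ^ 2) = n * V / (2 * (P * D)) ^ 2 := by field_simp
    rw [e2, Real.log_div (by positivity) (by positivity), Real.log_mul hnpos.ne' hV.ne',
      Real.log_pow, Real.log_mul two_ne_zero hPD.ne'] at hm2
    have e3 : Real.log (c * (P * D) / V) = Real.log c + Real.log (P * D) - Real.log V := by
      rw [Real.log_div (by positivity) hV.ne', Real.log_mul hc0.ne' hPD.ne']
    have l1 : Real.log 2 ≤ Real.log c := Real.log_le_log two_pos hc
    have l2 : Real.log V ≤ 0 := Real.log_nonpos hV.le hV1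
    push_cast at hm2
    rw [e3] 
    linarith
  have hfin := sseq_le hn hy2 hlog
  rw [ge_iff_le, div_mul_eq_mul_div, div_le_iff₀ (by positivity)]
  rw [le_div_iff₀ hV] at hfin
  linarith
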